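/- Let ρ : ℝ^N → [0,∞) be Borel measurable and locally bounded. There exists a bounded continuous function u : ℝ^N → ℝ such that −Δ^{α/2}u = ρ in the distributional sense on ℝ^N (i.e. ∫_{ℝ^N} u(x)·Δ^{α/2}θ(x) dx = −∫_{ℝ^N} ρ(x)·θ(x) dx for every θ ∈ C_c^∞(ℝ^N)) if and only if sup_{x ∈ ℝ^N} ∫_{ℝ^N} ρ(y)·|x−y|^{-(N−α)} dy < ∞. -/

import Mathlib

open MeasureTheory Real Filter Topology

noncomputable section

/-- The constant `c_{N,-α} = 2^α · π^{-N/2} · Γ((N+α)/2) / |Γ(-α/2)|`. -/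
def fracLapCoeff (N : ℕ) (α : ℝ) : ℝ :=
  2 ^ α * Real.pi ^ (-(N : ℝ) / 2) * Real.Gamma (((N : ℝ) + α) / 2) / |Real.Gamma (-α / 2)|

/-- The fractional Laplacian `Δ^{α/2}θ` of a test function `θ`. -/
def fracLap (N : ℕ) (α : ℝ) (θ : EuclideanSpace ℝ (Fin N) → ℝ)
    (x : EuclideanSpace ℝ (Fin N)) : ℝ :=
  (fracLapCoeff N α / 2) *
    ∫ z : EuclideanSpace ℝ (Fin N), (θ (x + z) + θ (x - z) - 2 * θ x) / ‖z‖ ^ ((N : ℝ) + α)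

/-- The symmetric second difference of `θ` at `x` with step `z`. -/
def secondDiff {E : Type*} [NormedAddCommGroup E] (θ : E → ℝ) (x z : E) : ℝ :=
  θ (x + z) + θ (x - z) - 2 * θ x

section SecondDifference

variable {E : Type*} [NormedAddCommGroup E]

lemma secondDiff_eq_zero_of_norm_le_one {θ : E → ℝ} {R : ℝ} (hR : ∀ x, R < ‖x‖ → θ x = 0)
    {x z : E} (hx : R + 1 < ‖x‖) (hz : ‖z‖ ≤ 1) : secondDiff θ x z = 0 := by
  have h1 : R < ‖x + z‖ := by
    have := norm_sub_le (x + z) z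
    rw [add_sub_cancel_right] at this
    linarith
  have h2 : R < ‖x - z‖ := by
    have := norm_add_le (x - z) z
    rw [sub_add_cancel] at this
    linarith
  simp [secondDiff, hR _ h1, hR _ h2, hR x (by linarith)]

lemma abs_secondDiff_le {θ : E → ℝ} (x z : E) :
    |secondDiff θ x z| ≤ |θ (x + z)| + |θ (x - z)| + 2 * |θ x| := by
  unfold secondDiff
  calc _ ≤ |θ (x + z) + θ (x - z)| + |2 * θ x| := abs_sub _ _
    _ ≤ _ := by
      rw [abs_mul, abs_two]
      gcongr
      exact abs_add_le _ _

variable [NormedSpace ℝ E]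

lemma abs_secondDiff_le_sq {θ : E → ℝ} (hθ : Differentiable ℝ θ) {K : NNReal}
    (hK : LipschitzWith K (fderiv ℝ θ)) (x z : E) :
    |secondDiff θ x z| ≤ 2 * K * ‖z‖ ^ 2 := by
  have hd : ∀ y ∈ Metric.closedBall (0 : E) ‖z‖,
      HasFDerivWithinAt (fun y => θ (x + y) + θ (x - y)) (fderiv ℝ θ (x + y) - fderiv ℝ θ (x - y))
        (Metric.closedBall (0 : E) ‖z‖) y := by
    intro y _
    have h1 : HasFDerivAt (fun y => θ (x + y)) (fderiv ℝ θ (x + y)) y :=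
      by
      simpa [Function.comp_def] using (hθ (x + y)).hasFDerivAt.comp y
        ((hasFDerivAt_id y).const_add x)
    have h2 : HasFDerivAt (fun y => θ (x - y)) (-fderiv ℝ θ (x - y)) y := by
      have := (hθ (x - y)).hasFDerivAt.comp y
        ((hasFDerivAt_id y).const_sub x)
      simpa [Function.comp_def] using this
    rw [sub_eq_add_neg]
    exact (h1.add h2).hasFDerivWithinAt
  have hb : ∀ y ∈ Metric.closedBall (0 : E) ‖z‖,
      ‖fderiv ℝ θ (x + y) - fderiv ℝ θ (x - y)‖ ≤ 2 * K * ‖z‖ := by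
    intro y hy
    rw [mem_closedBall_zero_iff] at hy
    calc _ ≤ K * ‖(x + y) - (x - y)‖ := hK.norm_sub_le _ _
      _ = K * ‖y + y‖ := by congr 2; abel
      _ ≤ K * (‖z‖ + ‖z‖) := by
        gcongr
        exact (norm_add_le _ _).trans (add_le_add hy hy)
      _ = _ := by ring
  have := (convex_closedBall (0 : E) ‖z‖).norm_image_sub_le_of_norm_hasFDerivWithin_le hd hb
    (Metric.mem_closedBall_self (norm_nonneg z)) (y := z) (by simp)
  have h3 : secondDiff θ x z = θ (x + z) + θ (x - z) - (θ (x + 0) + θ (x - 0)) := by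
    simp [secondDiff]; ring
  rw [h3, ← Real.norm_eq_abs]
  refine this.trans (le_of_eq ?_)
  rw [sub_zero]; ring

lemma exists_abs_secondDiff_le [FiniteDimensional ℝ E] {θ : E → ℝ} (hθ : ContDiff ℝ (⊤ : ℕ∞) θ)
    (hc : HasCompactSupport θ) :
    ∃ C, 0 ≤ C ∧ ∀ x z, |secondDiff θ x z| ≤ C * min (‖z‖ ^ 2) 1 := by
  obtain ⟨K, hK⟩ := ContDiff.lipschitzWith_of_hasCompactSupport (𝕂 := ℝ) (hc.fderiv ℝ)
    (hθ.fderiv_right (m := 1) (by norm_cast)) one_ne_zero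
  obtain ⟨M, hM⟩ := hc.exists_bound_of_continuous hθ.continuous
  have hM0 : 0 ≤ M := (norm_nonneg _).trans (hM 0)
  refine ⟨max (2 * K) (4 * M), by positivity, fun x z => ?_⟩
  rcases le_total (‖z‖ ^ 2) 1 with h | h
  · rw [min_eq_left h]
    refine (abs_secondDiff_le_sq (hθ.differentiable (by simp)) hK x z).trans ?_
    gcongr
    exact le_max_left _ _
  · rw [min_eq_right h, mul_one]
    refine (abs_secondDiff_le x z).trans (le_trans ?_ (le_max_right _ _))
    have := hM (x + z); have := hM (x - z); have := hM x
    simp only [Real.norm_eq_abs] at *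
    linarith

variable [FiniteDimensional ℝ E] [MeasurableSpace E] [BorelSpace E] (μ : Measure E)
  [μ.IsAddHaarMeasure]

omit [NormedSpace ℝ E] [FiniteDimensional ℝ E] in
lemma integrable_secondDiff {θ : E → ℝ} (hθ : Integrable θ μ) (z : E) :
    Integrable (fun x => secondDiff θ x z) μ :=
  ((hθ.comp_add_right z).add (hθ.comp_sub_right z)).sub (hθ.const_mul 2)

lemma exists_integral_abs_secondDiff_le {θ : E → ℝ} (hθ : ContDiff ℝ (⊤ : ℕ∞) θ)
    (hc : HasCompactSupport θ) :
    ∃ C, 0 ≤ C ∧ ∀ z, ∫ x, |secondDiff θ x z| ∂μ ≤ C * min (‖z‖ ^ 2) 1 := by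
  have hi : Integrable θ μ := hθ.continuous.integrable_of_hasCompactSupport hc
  obtain ⟨C, hC0, hC⟩ := exists_abs_secondDiff_le hθ hc
  obtain ⟨R, hR⟩ : ∃ R : ℝ, ∀ x, R < ‖x‖ → θ x = 0 := by
    obtain ⟨R, hR⟩ := hc.isCompact.isBounded.exists_norm_le
    refine ⟨R, fun x hx => ?_⟩
    by_contra h
    exact absurd (hR x (subset_tsupport _ h)) (not_le.2 hx)
  set V := μ.real (Metric.closedBall 0 (R + 1))
  refine ⟨max (C * V) (4 * ∫ x, |θ x| ∂μ),
    le_max_of_le_left (mul_nonneg hC0 measureReal_nonneg), fun z => ?_⟩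
  rcases le_total (‖z‖) 1 with h | h
  · have h1 : ∫ x, |secondDiff θ x z| ∂μ =
        ∫ x in Metric.closedBall 0 (R + 1), |secondDiff θ x z| ∂μ := by
      rw [setIntegral_eq_integral_of_forall_compl_eq_zero]
      intro x hx
      rw [mem_closedBall_zero_iff, not_le] at hx
      rw [secondDiff_eq_zero_of_norm_le_one hR hx h, abs_zero]
    have h2 : ∫ x in Metric.closedBall 0 (R + 1), |secondDiff θ x z| ∂μ
        ≤ (C * min (‖z‖ ^ 2) 1) * V := by
      refine (le_abs_self _).trans ?_
      rw [← Real.norm_eq_abs]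
      refine norm_setIntegral_le_of_norm_le_const Metric.isBounded_closedBall.measure_lt_top ?_
      intro x _
      simpa using hC x z
    rw [h1]
    refine h2.trans ?_
    calc (C * min (‖z‖ ^ 2) 1) * V = (C * V) * min (‖z‖ ^ 2) 1 := by ring
      _ ≤ _ := by gcongr; exact le_max_left _ _
  · rw [min_eq_right (by nlinarith), mul_one]
    refine le_trans ?_ (le_max_right _ _)
    have ha := hi.abs
    calc ∫ x, |secondDiff θ x z| ∂μ
        ≤ ∫ x, (|θ (x + z)| + |θ (x - z)| + 2 * |θ x|) ∂μ := by
          refine integral_mono (integrable_secondDiff μ hi z).abs ?_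
            (fun x => abs_secondDiff_le x z)
          exact ((ha.comp_add_right z).add (ha.comp_sub_right z)).add (ha.const_mul 2)
      _ = 4 * ∫ x, |θ x| ∂μ := by
          rw [integral_add, integral_add, integral_add_right_eq_self (fun x => |θ x|),
            integral_sub_right_eq_self (fun x => |θ x|), integral_const_mul]
          · ring
          · exact ha.comp_add_right z
          · exact ha.comp_sub_right z
          · exact (ha.comp_add_right z).add (ha.comp_sub_right z)
          · exact ha.const_mul 2

end SecondDifference

section Kernels

variable {E : Type*} [NormedAddCommGroup E] [NormedSpace ℝ E] [FiniteDimensional ℝ E]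
  [MeasurableSpace E] [BorelSpace E] (μ : Measure E) [μ.IsAddHaarMeasure]

lemma integrable_min_sq_one_div_norm_rpow [Nontrivial E] {α : ℝ} (h0 : 0 < α) (h2 : α < 2) :
    Integrable (fun z : E => min (‖z‖ ^ 2) 1 / ‖z‖ ^ ((Module.finrank ℝ E : ℝ) + α)) μ := by
  rw [integrable_fun_norm_addHaar μ
    (f := fun r => min (r ^ 2) 1 / r ^ ((Module.finrank ℝ E : ℝ) + α))]
  have hd : 1 ≤ Module.finrank ℝ E := Module.finrank_pos
  have key : ∀ r : ℝ, 0 < r → r ^ (Module.finrank ℝ E - 1) •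
      (min (r ^ 2) 1 / r ^ ((Module.finrank ℝ E : ℝ) + α)) = min (r ^ 2) 1 * r ^ (-1 - α) := by
    intro r hr
    rw [smul_eq_mul, ← Real.rpow_natCast r (Module.finrank ℝ E - 1), Nat.cast_sub hd,
      div_eq_mul_inv, ← Real.rpow_neg hr.le, mul_left_comm, ← Real.rpow_add hr]
    congr 2
    push_cast
    ring
  rw [integrableOn_congr_fun (s := Set.Ioi 0) (fun r hr => key r hr) measurableSet_Ioi,
    ← Set.Ioc_union_Ioi_eq_Ioi zero_le_one, integrableOn_union]
  constructor
  · have : IntegrableOn (fun r : ℝ => r ^ (1 - α)) (Set.Ioc 0 1) := by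
      rw [← intervalIntegrable_iff_integrableOn_Ioc_of_le zero_le_one]
      exact intervalIntegral.intervalIntegrable_rpow' (by linarith)
    refine this.congr_fun (fun r hr => ?_) measurableSet_Ioc
    have h1 : r ^ 2 ≤ 1 := pow_le_one₀ hr.1.le hr.2
    simp only
    rw [min_eq_left h1, ← Real.rpow_natCast r 2, ← Real.rpow_add hr.1]
    congr 1
    push_cast
    ring
  · have : IntegrableOn (fun r : ℝ => r ^ (-1 - α)) (Set.Ioi 1) :=
      integrableOn_Ioi_rpow_of_lt (by linarith) one_pos
    refine this.congr_fun (fun r hr => ?_) measurableSet_Ioi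
    have h1 : 1 ≤ r ^ 2 := one_le_pow₀ (le_of_lt hr)
    simp only
    rw [min_eq_right h1, one_mul]

lemma integrableOn_ball_norm_rpow [Nontrivial E] {β : ℝ} (hβ : β < Module.finrank ℝ E) (r : ℝ) :
    IntegrableOn (fun x : E => ‖x‖ ^ (-β)) (Metric.ball 0 r) μ :=
  integrableOn_ball_of_norm_le_rpow (C := 1) Module.finrank_pos hβ
    (Eventually.of_forall fun x => by
      rw [one_mul, Real.norm_of_nonneg (by positivity)])
    ((measurable_norm.pow_const _).aestronglyMeasurable)

end Kernels

section SingularIntegral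

variable {E : Type*} [NormedAddCommGroup E] [InnerProductSpace ℝ E] [FiniteDimensional ℝ E]
  [MeasurableSpace E] [BorelSpace E]

/-- The singular integral `∫ (θ(x+z) + θ(x-z) - 2θ(x)) ‖z‖^{-(d+α)} dz`, `d = dim E`: a positive
multiple of the fractional Laplacian of order `α / 2`. -/
def secondDiffIntegral (α : ℝ) (θ : E → ℝ) (x : E) : ℝ :=
  ∫ z, secondDiff θ x z / ‖z‖ ^ ((Module.finrank ℝ E : ℝ) + α)

variable [Nontrivial E] {α : ℝ} {θ : E → ℝ}

lemma integrable_prod_secondDiff (h0 : 0 < α) (h2 : α < 2) (hθ : ContDiff ℝ (⊤ : ℕ∞) θ)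
    (hc : HasCompactSupport θ) :
    Integrable (fun p : E × E => secondDiff θ p.1 p.2 / ‖p.2‖ ^ ((Module.finrank ℝ E : ℝ) + α))
      (volume.prod volume) := by
  have hi : Integrable θ := hθ.continuous.integrable_of_hasCompactSupport hc
  obtain ⟨C, hC0, hC⟩ := exists_integral_abs_secondDiff_le volume hθ hc
  have hθc := hθ.continuous
  have hm : Measurable
      (fun p : E × E => secondDiff θ p.1 p.2 / ‖p.2‖ ^ ((Module.finrank ℝ E : ℝ) + α)) := by
    refine Measurable.div ?_ (measurable_snd.norm.pow_const _)
    unfold secondDiff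
    exact Continuous.measurable (by fun_prop)
  rw [integrable_prod_iff' hm.aestronglyMeasurable]
  refine ⟨Eventually.of_forall fun z => ?_, ?_⟩
  · exact (integrable_secondDiff volume hi z).div_const (‖z‖ ^ ((Module.finrank ℝ E : ℝ) + α))
  refine ((integrable_min_sq_one_div_norm_rpow (E := E) volume h0 h2).const_mul C).mono'
    hm.norm.stronglyMeasurable.integral_prod_left'.aestronglyMeasurable
    (Eventually.of_forall fun z => ?_)
  rw [Real.norm_of_nonneg (by positivity)]
  have h1 : ∀ x, ‖secondDiff θ x z / ‖z‖ ^ ((Module.finrank ℝ E : ℝ) + α)‖ =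
      |secondDiff θ x z| / ‖z‖ ^ ((Module.finrank ℝ E : ℝ) + α) := by
    intro x
    rw [norm_div, Real.norm_eq_abs, Real.norm_of_nonneg (by positivity)]
  simp only [h1]
  rw [integral_div, ← mul_div_assoc]
  gcongr
  exact hC z

lemma integrable_secondDiffIntegral (h0 : 0 < α) (h2 : α < 2) (hθ : ContDiff ℝ (⊤ : ℕ∞) θ)
    (hc : HasCompactSupport θ) : Integrable (secondDiffIntegral α θ) :=
  (integrable_prod_secondDiff h0 h2 hθ hc).integral_prod_left

lemma exists_abs_secondDiffIntegral_le (h0 : 0 < α) (h2 : α < 2) (hθ : ContDiff ℝ (⊤ : ℕ∞) θ)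
    (hc : HasCompactSupport θ) : ∃ M, ∀ x, |secondDiffIntegral α θ x| ≤ M := by
  obtain ⟨C, hC0, hC⟩ := exists_abs_secondDiff_le hθ hc
  refine ⟨∫ z : E, C * (min (‖z‖ ^ 2) 1 / ‖z‖ ^ ((Module.finrank ℝ E : ℝ) + α)), fun x => ?_⟩
  rw [secondDiffIntegral, ← Real.norm_eq_abs]
  refine norm_integral_le_of_norm_le
    ((integrable_min_sq_one_div_norm_rpow (E := E) volume h0 h2).const_mul C)
    (Eventually.of_forall fun z => ?_)
  rw [norm_div, Real.norm_eq_abs, Real.norm_of_nonneg (by positivity : 0 ≤ ‖z‖ ^ (_ : ℝ)),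
    ← mul_div_assoc]
  gcongr
  exact hC x z

omit [Nontrivial E] in
lemma secondDiffIntegral_comp_add_right (θ : E → ℝ) (x y : E) :
    secondDiffIntegral α (fun x => θ (x + y)) x = secondDiffIntegral α θ (x + y) := by
  simp only [secondDiffIntegral, secondDiff]
  congr 1 with z
  rw [add_right_comm, sub_add_eq_add_sub]

end SingularIntegral

section Symbol

variable {E : Type*} [NormedAddCommGroup E] [InnerProductSpace ℝ E] [FiniteDimensional ℝ E]
  [MeasurableSpace E] [BorelSpace E] {α : ℝ}

open scoped InnerProductSpace

/-- Minus the Fourier symbol of `secondDiffIntegral`. -/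
def levySymbol (α : ℝ) (ξ : E) : ℝ :=
  ∫ z : E, (2 - 2 * cos (2 * π * ⟪z, ξ⟫_ℝ)) / ‖z‖ ^ ((Module.finrank ℝ E : ℝ) + α)

lemma integrable_levySymbol [Nontrivial E] (h0 : 0 < α) (h2 : α < 2) (ξ : E) :
    Integrable (fun z : E =>
      (2 - 2 * cos (2 * π * ⟪z, ξ⟫_ℝ)) / ‖z‖ ^ ((Module.finrank ℝ E : ℝ) + α)) := by
  refine ((integrable_min_sq_one_div_norm_rpow (E := E) volume h0 h2).const_mul
    ((2 * π * ‖ξ‖) ^ 2 + 4)).mono' ?_ (Eventually.of_forall fun z => ?_)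
  · refine Measurable.aestronglyMeasurable (Measurable.div ?_ (measurable_norm.pow_const _))
    exact Continuous.measurable (by fun_prop)
  · rw [norm_div, Real.norm_of_nonneg (by positivity : 0 ≤ ‖z‖ ^ (_ : ℝ)), ← mul_div_assoc]
    gcongr
    have hcos := cos_le_one (2 * π * ⟪z, ξ⟫_ℝ)
    have hcos' := neg_one_le_cos (2 * π * ⟪z, ξ⟫_ℝ)
    have hsq := one_sub_sq_div_two_le_cos (x := 2 * π * ⟪z, ξ⟫_ℝ)
    rw [Real.norm_of_nonneg (by linarith)]
    have hin : ⟪z, ξ⟫_ℝ ^ 2 ≤ (‖z‖ * ‖ξ‖) ^ 2 := by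
      rw [← sq_abs]
      gcongr
      exact abs_real_inner_le_norm z ξ
    rcases le_total (‖z‖ ^ 2) 1 with h | h
    · rw [min_eq_left h]
      have : (2 * π) ^ 2 * ⟪z, ξ⟫_ℝ ^ 2 ≤ (2 * π) ^ 2 * (‖z‖ * ‖ξ‖) ^ 2 := by gcongr
      nlinarith [sq_nonneg ‖z‖]
    · rw [min_eq_right h]
      nlinarith [sq_nonneg (2 * π * ‖ξ‖)]

lemma levySymbol_eq_of_norm_eq {ξ η : E} (h : ‖ξ‖ = ‖η‖) :
    levySymbol α ξ = levySymbol α η := by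
  set T := (Submodule.span ℝ {ξ - η})ᗮ.reflection
  have hT : T ξ = η := Submodule.reflection_sub h
  unfold levySymbol
  rw [← T.measurePreserving.integral_comp T.toHomeomorph.measurableEmbedding
    (fun z => (2 - 2 * cos (2 * π * ⟪z, η⟫_ℝ)) / ‖z‖ ^ ((Module.finrank ℝ E : ℝ) + α))]
  congr 1 with z
  rw [← hT, T.inner_map_map, T.norm_map]

lemma levySymbol_smul (ξ : E) {r : ℝ} (hr : 0 < r) :
    levySymbol α (r • ξ) = r ^ α * levySymbol α ξ := by
  have := Measure.integral_comp_smul (volume : Measure E)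
    (fun z => (2 - 2 * cos (2 * π * ⟪z, ξ⟫_ℝ)) / ‖z‖ ^ ((Module.finrank ℝ E : ℝ) + α)) r
  rw [abs_of_pos (by positivity), smul_eq_mul, inv_mul_eq_div, eq_div_iff (by positivity)] at this
  unfold levySymbol
  rw [← this, ← integral_mul_const, ← integral_const_mul]
  congr 1 with z
  rw [inner_smul_left, inner_smul_right, norm_smul, Real.norm_of_nonneg hr.le,
    Real.mul_rpow hr.le (norm_nonneg z), Real.rpow_add hr, Real.rpow_natCast]
  have : 0 < r ^ α := by positivity
  have : 0 < r ^ (Module.finrank ℝ E) := by positivity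
  simp only [conj_trivial]
  field_simp

lemma levySymbol_pos [Nontrivial E] (h0 : 0 < α) (h2 : α < 2) {ξ : E} (hξ : ξ ≠ 0) :
    0 < levySymbol α ξ := by
  unfold levySymbol
  rw [integral_pos_iff_support_of_nonneg (fun z => ?_) (integrable_levySymbol h0 h2 ξ)]
  · have ho : IsOpen {z : E | 0 < ⟪z, ξ⟫_ℝ ∧ ⟪z, ξ⟫_ℝ < 1} :=
      IsOpen.inter (s := {z : E | 0 < ⟪z, ξ⟫_ℝ}) (t := {z : E | ⟪z, ξ⟫_ℝ < 1})
        (isOpen_lt (by fun_prop) (by fun_prop)) (isOpen_lt (by fun_prop) (by fun_prop))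
    have hn : 0 < ‖ξ‖ ^ 2 := by positivity
    refine (ho.measure_pos volume ⟨(2 * ‖ξ‖ ^ 2)⁻¹ • ξ, ?_⟩).trans_le (measure_mono ?_)
    · have : ⟪(2 * ‖ξ‖ ^ 2)⁻¹ • ξ, ξ⟫_ℝ = 1 / 2 := by
        rw [inner_smul_left, real_inner_self_eq_norm_sq]
        simp only [conj_trivial]
        field_simp
      simp only [Set.mem_ofPred_eq, this]
      norm_num
    · rintro z ⟨hz0, hz1⟩
      have hz : z ≠ 0 := by rintro rfl; simp at hz0
      have hlt : cos (2 * π * ⟪z, ξ⟫_ℝ) ≠ 1 := by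
        intro h
        rw [cos_eq_one_iff_of_lt_of_lt] at h
        · have := mul_pos two_pi_pos hz0
          linarith
        · have := mul_pos two_pi_pos hz0
          linarith [two_pi_pos]
        · nlinarith [two_pi_pos]
      have hp : 0 < ‖z‖ ^ ((Module.finrank ℝ E : ℝ) + α) := by positivity
      refine div_ne_zero (fun h => hlt (by linarith)) hp.ne'
  · have := cos_le_one (2 * π * ⟪z, ξ⟫_ℝ)
    exact div_nonneg (by linarith) (by positivity)

lemma exists_levySymbol_eq [Nontrivial E] (h0 : 0 < α) (h2 : α < 2) :
    ∃ K, 0 < K ∧ ∀ ξ : E, levySymbol α ξ = K * ‖ξ‖ ^ α := by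
  obtain ⟨e, he⟩ := exists_norm_eq E zero_le_one
  refine ⟨levySymbol α e, levySymbol_pos h0 h2 (by rintro rfl; simp at he), fun ξ => ?_⟩
  rcases eq_or_ne ξ 0 with rfl | hξ
  · simp [levySymbol, h0.ne']
  · have hn : 0 < ‖ξ‖ := norm_pos_iff.2 hξ
    rw [levySymbol_eq_of_norm_eq (η := ‖ξ‖ • e) (by rw [norm_smul, he]; simp),
      levySymbol_smul e hn, mul_comm]

open scoped FourierTransform

lemma fourier_secondDiff {θ : E → ℝ} (hθ : Integrable θ) (z ξ : E) :
    𝓕 (fun x => (secondDiff θ x z : ℂ)) ξ =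
      -((2 - 2 * cos (2 * π * ⟪z, ξ⟫_ℝ) : ℝ) : ℂ) * 𝓕 (fun x => (θ x : ℂ)) ξ := by
  have hi : Integrable (fun x => (θ x : ℂ)) := hθ.ofReal
  have ht : ∀ v : E, 𝓕 (fun x => (θ (x + v) : ℂ)) ξ =
      Complex.exp (2 * π * ⟪v, ξ⟫_ℝ * Complex.I) * 𝓕 (fun x => (θ x : ℂ)) ξ := by
    intro v
    have := congrFun (VectorFourier.fourierIntegral_comp_add_right Real.fourierChar
      (volume : Measure E) (innerₗ E) (fun x => (θ x : ℂ)) v) ξ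
    simp only [Circle.smul_def, Real.fourierChar_apply, innerₗ_apply_apply, smul_eq_mul] at this
    push_cast at this
    exact this
  have hs : (fun x => (secondDiff θ x z : ℂ)) = (fun x => (θ (x + z) : ℂ)) +
      (fun x => (θ (x + -z) : ℂ)) + (-2 : ℂ) • fun x => (θ x : ℂ) := by
    ext x
    simp [secondDiff, ← sub_eq_add_neg]
  have hadd : ∀ f g : E → ℂ, Integrable f → Integrable g → 𝓕 (f + g) ξ = 𝓕 f ξ + 𝓕 g ξ := by
    intro f g hf hg
    exact congrFun (VectorFourier.fourierIntegral_add (L := innerₗ E) Real.continuous_fourierChar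
      continuous_inner hf hg) ξ
  have hsm : ∀ (c : ℂ) (f : E → ℂ), 𝓕 (c • f) ξ = c * 𝓕 f ξ := by
    intro c f
    exact congrFun (VectorFourier.fourierIntegral_const_smul Real.fourierChar
      (volume : Measure E) (innerₗ E) f c) ξ
  rw [hs, hadd _ _ ((hi.comp_add_right z).add (hi.comp_add_right (-z))) (hi.smul _),
    hadd _ _ (hi.comp_add_right z) (hi.comp_add_right (-z)), hsm, ht, ht, inner_neg_left]
  push_cast
  rw [Complex.cos]
  ring_nf

lemma fourier_secondDiffIntegral [Nontrivial E] {θ : E → ℝ} (h0 : 0 < α) (h2 : α < 2)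
    (hθ : ContDiff ℝ (⊤ : ℕ∞) θ) (hc : HasCompactSupport θ) (ξ : E) :
    𝓕 (fun x => (secondDiffIntegral α θ x : ℂ)) ξ =
      -(levySymbol α ξ : ℂ) * 𝓕 (fun x => (θ x : ℂ)) ξ := by
  have hi : Integrable θ := hθ.continuous.integrable_of_hasCompactSupport hc
  set s : ℝ := (Module.finrank ℝ E : ℝ) + α
  have h_int : Integrable (Function.uncurry fun x z : E =>
      Real.fourierChar (-⟪x, ξ⟫_ℝ) • ((secondDiff θ x z / ‖z‖ ^ s : ℝ) : ℂ))
      (volume.prod volume) := by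
    refine ((integrable_prod_secondDiff h0 h2 hθ hc).ofReal (𝕜 := ℂ)).mono ?_
      (Eventually.of_forall fun p => ?_)
    · refine AEStronglyMeasurable.smul (𝕜 := Circle) ?_
        ((integrable_prod_secondDiff h0 h2 hθ hc).ofReal (𝕜 := ℂ)).aestronglyMeasurable
      exact Continuous.aestronglyMeasurable
        (Real.continuous_fourierChar.comp (by fun_prop))
    · simp only [Function.uncurry, Circle.norm_smul]
      exact le_rfl
  calc 𝓕 (fun x => (secondDiffIntegral α θ x : ℂ)) ξ
      = ∫ x, ∫ z, Real.fourierChar (-⟪x, ξ⟫_ℝ) • ((secondDiff θ x z / ‖z‖ ^ s : ℝ) : ℂ) := by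
        rw [Real.fourier_eq]
        congr 1 with x
        simp only [Circle.smul_def, smul_eq_mul]
        rw [integral_const_mul, integral_complex_ofReal]
        rfl
    _ = ∫ z, ∫ x, Real.fourierChar (-⟪x, ξ⟫_ℝ) • ((secondDiff θ x z / ‖z‖ ^ s : ℝ) : ℂ) :=
        integral_integral_swap h_int
    _ = ∫ z, -(((2 - 2 * cos (2 * π * ⟪z, ξ⟫_ℝ)) / ‖z‖ ^ s : ℝ) : ℂ) *
          𝓕 (fun x => (θ x : ℂ)) ξ := by
        congr 1 with z
        have := fourier_secondDiff hi z ξ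
        rw [Real.fourier_eq] at this
        have h3 : ∀ x, Real.fourierChar (-⟪x, ξ⟫_ℝ) • ((secondDiff θ x z / ‖z‖ ^ s : ℝ) : ℂ) =
            (Real.fourierChar (-⟪x, ξ⟫_ℝ) • (secondDiff θ x z : ℂ)) / ((‖z‖ ^ s : ℝ) : ℂ) := by
          intro x
          rw [Circle.smul_def, Circle.smul_def, smul_eq_mul, smul_eq_mul, Complex.ofReal_div,
            mul_div_assoc]
        simp only [h3]
        rw [integral_div, this, Complex.ofReal_div]
        ring
    _ = _ := by
        rw [integral_mul_const, integral_neg, integral_complex_ofReal]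
        rfl

end Symbol

section Subordination

lemma integral_rpow_mul_exp_neg_div_Ioi {a c : ℝ} (ha : 0 < a) (hc : 0 < c) :
    ∫ t in Set.Ioi 0, t ^ (-a - 1) * exp (-(c / t)) = (1 / c) ^ a * Real.Gamma a := by
  rw [← Real.integral_rpow_mul_exp_neg_mul_Ioi ha hc,
    ← integral_comp_rpow_Ioi (fun t => t ^ (a - 1) * exp (-(c * t))) (p := -1) (by norm_num)]
  refine setIntegral_congr_fun measurableSet_Ioi fun t (ht : 0 < t) => ?_
  simp only [abs_neg, abs_one, one_mul, smul_eq_mul]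
  rw [← Real.rpow_mul ht.le, ← mul_assoc, ← Real.rpow_add ht, Real.rpow_neg_one, div_eq_mul_inv]
  ring_nf

lemma integrableOn_rpow_mul_exp_neg_mul_Ioi {a c : ℝ} (ha : 0 < a) (hc : 0 < c) :
    IntegrableOn (fun t => t ^ (a - 1) * exp (-(c * t))) (Set.Ioi 0) := by
  refine Integrable.of_integral_ne_zero ?_
  rw [Real.integral_rpow_mul_exp_neg_mul_Ioi ha hc]
  have := Real.Gamma_pos_of_pos ha
  positivity

lemma integrableOn_rpow_mul_exp_neg_div_Ioi {a c : ℝ} (ha : 0 < a) (hc : 0 < c) :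
    IntegrableOn (fun t => t ^ (-a - 1) * exp (-(c / t))) (Set.Ioi 0) := by
  refine Integrable.of_integral_ne_zero ?_
  rw [integral_rpow_mul_exp_neg_div_Ioi ha hc]
  have := Real.Gamma_pos_of_pos ha
  positivity

lemma integral_ofReal_mul_eq_integral_integral {X : Type*} [MeasurableSpace X] {μ : Measure X}
    [SFinite μ] {k : X → ℝ → ℝ} {κ : X → ℝ} {h : X → ℂ} (hk : Measurable (Function.uncurry k))
    (hk0 : ∀ x, ∀ t, 0 < t → 0 ≤ k x t) (hki : ∀ᵐ x ∂μ, IntegrableOn (k x) (Set.Ioi 0))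
    (hκ : ∀ᵐ x ∂μ, ∫ t in Set.Ioi 0, k x t = κ x) (hh : AEStronglyMeasurable h μ)
    (h_int : Integrable (fun x => κ x * ‖h x‖) μ) :
    ∫ x, (κ x : ℂ) * h x ∂μ = ∫ t in Set.Ioi 0, ∫ x, (k x t : ℂ) * h x ∂μ := by
  have hI : Integrable (Function.uncurry fun x t => (k x t : ℂ) * h x)
      (μ.prod (volume.restrict (Set.Ioi 0))) := by
    rw [integrable_prod_iff]
    · refine ⟨?_, ?_⟩
      · filter_upwards [hki] with x hx
        exact (hx.ofReal (𝕜 := ℂ)).mul_const (h x)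
      · refine h_int.congr ?_
        filter_upwards [hκ] with x hx
        rw [← hx, ← integral_mul_const]
        refine setIntegral_congr_fun measurableSet_Ioi fun t (ht : 0 < t) => ?_
        simp [abs_of_nonneg (hk0 x t ht)]
    · exact (Complex.measurable_ofReal.comp hk).aestronglyMeasurable.mul hh.comp_fst
  rw [← integral_integral_swap hI]
  refine integral_congr_ae ?_
  filter_upwards [hκ] with x hx
  rw [integral_mul_const, integral_complex_ofReal, hx]

end Subordination

section RieszKernel

variable {E : Type*} [NormedAddCommGroup E] [InnerProductSpace ℝ E] [FiniteDimensional ℝ E]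
  [MeasurableSpace E] [BorelSpace E] [Nontrivial E] {α : ℝ}

open scoped FourierTransform

lemma integrable_norm_rpow_mul {β : ℝ} (hβ0 : 0 ≤ β) (hβ : β < Module.finrank ℝ E) {h : E → ℝ}
    (hh : Integrable h) {M : ℝ} (hM : ∀ x, |h x| ≤ M) :
    Integrable (fun x => ‖x‖ ^ (-β) * h x) := by
  have h1 : Integrable ((Metric.ball (0 : E) 1).indicator fun x => ‖x‖ ^ (-β)) :=
    (integrable_indicator_iff Metric.isOpen_ball.measurableSet).2
      (integrableOn_ball_norm_rpow volume hβ 1)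
  refine ((h1.mul_const M).add hh.abs).mono'
    ((measurable_norm.pow_const _).aestronglyMeasurable.mul hh.aestronglyMeasurable)
    (Eventually.of_forall fun x => ?_)
  have hp : 0 ≤ ‖x‖ ^ (-β) := by positivity
  simp only [Pi.add_apply, Real.norm_eq_abs, abs_mul, abs_of_nonneg hp]
  by_cases hx : x ∈ Metric.ball (0 : E) 1
  · rw [Set.indicator_of_mem hx]
    have := mul_le_mul_of_nonneg_left (hM x) hp
    linarith [abs_nonneg (h x)]
  · rw [Set.indicator_of_notMem hx, zero_mul, zero_add]
    rw [mem_ball_zero_iff, not_lt] at hx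
    exact mul_le_of_le_one_left (abs_nonneg _)
      (Real.rpow_le_one_of_one_le_of_nonpos hx (by linarith))

omit [Nontrivial E] in
lemma integral_gaussian_mul_eq_fourier {g : E → ℂ} (hg : Integrable g) {t : ℝ} (ht : 0 < t) :
    ∫ x, (exp (-(‖x‖ ^ 2 * t)) : ℂ) * g x =
      ((π / t) ^ ((Module.finrank ℝ E : ℝ) / 2) : ℝ) *
        ∫ ξ, (exp (-(π ^ 2 * ‖ξ‖ ^ 2 / t)) : ℂ) * 𝓕 g ξ := by
  have hb : 0 < π ^ 2 / t := by positivity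
  have hbc : 0 < ((π ^ 2 / t : ℝ) : ℂ).re := by rwa [Complex.ofReal_re]
  have key := VectorFourier.integral_fourierIntegral_smul_eq_flip (L := innerₗ E)
    Real.continuous_fourierChar continuous_inner
    (f := fun v : E => Complex.exp (-((π ^ 2 / t : ℝ) : ℂ) * ‖v‖ ^ 2)) (g := g)
    (μ := volume) (ν := volume)
    (by simpa using GaussianFourier.integrable_cexp_neg_mul_sq_norm_add (V := E) hbc 0 0) hg
  have hflip : (innerₗ E).flip = innerₗ E := by
    ext x y
    simp
  rw [hflip] at key
  have h1 : ∀ x : E, VectorFourier.fourierIntegral Real.fourierChar volume (innerₗ E)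
      (fun v : E => Complex.exp (-((π ^ 2 / t : ℝ) : ℂ) * ‖v‖ ^ 2)) x =
      (((t / π) ^ ((Module.finrank ℝ E : ℝ) / 2) : ℝ) : ℂ) * (exp (-(‖x‖ ^ 2 * t)) : ℂ) := by
    intro x
    refine (fourier_gaussian_innerProductSpace hbc x).trans ?_
    rw [Complex.ofReal_cpow (by positivity)]
    congr 2
    · push_cast
      have : (π : ℂ) ≠ 0 := by exact_mod_cast pi_ne_zero
      have : (t : ℂ) ≠ 0 := by exact_mod_cast ht.ne'
      field_simp
    · push_cast
      rfl
    · push_cast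
      have : (π : ℂ) ≠ 0 := by exact_mod_cast pi_ne_zero
      have : (t : ℂ) ≠ 0 := by exact_mod_cast ht.ne'
      field_simp
  have h2 : ∀ ξ : E, Complex.exp (-((π ^ 2 / t : ℝ) : ℂ) * ‖ξ‖ ^ 2) =
      (exp (-(π ^ 2 * ‖ξ‖ ^ 2 / t)) : ℂ) := by
    intro ξ
    push_cast
    congr 1
    ring
  simp only [h1, smul_eq_mul, mul_assoc] at key
  simp only [h2] at key
  rw [integral_const_mul] at key
  change _ = ∫ ξ, (exp (-(π ^ 2 * ‖ξ‖ ^ 2 / t)) : ℂ) * 𝓕 g ξ at key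
  rw [← key, ← mul_assoc, ← Complex.ofReal_mul, ← Real.mul_rpow (by positivity) (by positivity)]
  rw [show π / t * (t / π) = 1 by field_simp, Real.one_rpow]
  simp

lemma Gamma_mul_integral_norm_rpow_mul {g : E → ℂ} (h0 : 0 < α) (hα : α < Module.finrank ℝ E)
    (hg : Integrable g) (hgi : Integrable fun x => ‖x‖ ^ (-((Module.finrank ℝ E : ℝ) - α)) * ‖g x‖)
    (hgf : Integrable fun ξ => ‖ξ‖ ^ (-α) * ‖𝓕 g ξ‖) :
    (Real.Gamma (((Module.finrank ℝ E : ℝ) - α) / 2) : ℂ) *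
        ∫ x, ((‖x‖ ^ (-((Module.finrank ℝ E : ℝ) - α)) : ℝ) : ℂ) * g x =
      (π ^ ((Module.finrank ℝ E : ℝ) / 2 - α) * Real.Gamma (α / 2) : ℝ) *
        ∫ ξ, ((‖ξ‖ ^ (-α) : ℝ) : ℂ) * 𝓕 g ξ := by
  set d : ℝ := (Module.finrank ℝ E : ℝ)
  have hs : 0 < (d - α) / 2 := by linarith
  have hα2 : 0 < α / 2 := by linarith
  have hne : ∀ᵐ x : E, x ≠ 0 := by simp [ae_iff]
  have hfc : AEStronglyMeasurable (𝓕 g) volume :=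
    (VectorFourier.fourierIntegral_continuous (L := innerₗ E) Real.continuous_fourierChar
      continuous_inner hg).aestronglyMeasurable
  have e1 : ∫ x, ((Real.Gamma ((d - α) / 2) * ‖x‖ ^ (-(d - α)) : ℝ) : ℂ) * g x =
      ∫ t in Set.Ioi 0, ∫ x, ((t ^ ((d - α) / 2 - 1) * exp (-(‖x‖ ^ 2 * t)) : ℝ) : ℂ) * g x := by
    refine integral_ofReal_mul_eq_integral_integral
      (k := fun x t => t ^ ((d - α) / 2 - 1) * exp (-(‖x‖ ^ 2 * t))) ?_ ?_ ?_ ?_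
      hg.aestronglyMeasurable ?_
    · simp only [Function.uncurry_def]
      fun_prop
    · intro x t ht
      positivity
    · filter_upwards [hne] with x hx
      exact integrableOn_rpow_mul_exp_neg_mul_Ioi hs (by positivity)
    · filter_upwards [hne] with x hx
      have hx' : 0 < ‖x‖ := norm_pos_iff.2 hx
      rw [Real.integral_rpow_mul_exp_neg_mul_Ioi hs (by positivity), mul_comm, one_div,
        ← Real.rpow_neg_one, ← Real.rpow_mul (by positivity), ← Real.rpow_natCast ‖x‖ 2,
        ← Real.rpow_mul hx'.le]
      congr 2
      push_cast
      ring
    · simpa only [mul_assoc] using hgi.const_mul (Real.Gamma ((d - α) / 2))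
  have e2 : ∫ ξ, ((π ^ (-α) * Real.Gamma (α / 2) * ‖ξ‖ ^ (-α) : ℝ) : ℂ) * 𝓕 g ξ =
      ∫ t in Set.Ioi 0,
        ∫ ξ, ((t ^ (-(α / 2) - 1) * exp (-(π ^ 2 * ‖ξ‖ ^ 2 / t)) : ℝ) : ℂ) * 𝓕 g ξ := by
    refine integral_ofReal_mul_eq_integral_integral
      (k := fun ξ t => t ^ (-(α / 2) - 1) * exp (-(π ^ 2 * ‖ξ‖ ^ 2 / t))) ?_ ?_ ?_ ?_ hfc ?_
    · simp only [Function.uncurry_def]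
      fun_prop
    · intro x t ht
      positivity
    · filter_upwards [hne] with x hx
      exact integrableOn_rpow_mul_exp_neg_div_Ioi hα2 (by positivity)
    · filter_upwards [hne] with x hx
      have hx' : 0 < ‖x‖ := norm_pos_iff.2 hx
      rw [integral_rpow_mul_exp_neg_div_Ioi hα2 (by positivity), one_div,
        ← Real.rpow_neg_one, ← Real.rpow_mul (by positivity), ← mul_pow,
        ← Real.rpow_natCast (π * ‖x‖) 2, ← Real.rpow_mul (by positivity),
        Real.mul_rpow pi_pos.le hx'.le]
      have : ((2 : ℕ) : ℝ) * (-1 * (α / 2)) = -α := by push_cast; ring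
      rw [this]
      ring
    · simpa only [mul_assoc] using
        (hgf.const_mul (Real.Gamma (α / 2))).const_mul (π ^ (-α))
  have e3 : ∀ t ∈ Set.Ioi (0 : ℝ),
      ∫ x, ((t ^ ((d - α) / 2 - 1) * exp (-(‖x‖ ^ 2 * t)) : ℝ) : ℂ) * g x =
      (π ^ (d / 2) : ℝ) *
        ∫ ξ, ((t ^ (-(α / 2) - 1) * exp (-(π ^ 2 * ‖ξ‖ ^ 2 / t)) : ℝ) : ℂ) * 𝓕 g ξ := by
    intro t (ht : 0 < t)
    simp only [Complex.ofReal_mul, mul_assoc]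
    rw [integral_const_mul, integral_const_mul, integral_gaussian_mul_eq_fourier hg ht,
      ← mul_assoc, ← mul_assoc, ← Complex.ofReal_mul, ← Complex.ofReal_mul,
      Real.div_rpow pi_pos.le ht.le, mul_div_assoc', mul_comm (t ^ _), mul_div_assoc,
      ← Real.rpow_sub ht]
    congr 4
    ring
  rw [setIntegral_congr_fun measurableSet_Ioi e3, integral_const_mul, ← e2] at e1
  simp only [Complex.ofReal_mul, mul_assoc] at e1
  rw [integral_const_mul, integral_const_mul, integral_const_mul] at e1
  rw [e1, sub_eq_add_neg, Real.rpow_add pi_pos]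
  push_cast
  ring

omit [Nontrivial E] in
lemma integrable_fourier_of_hasCompactSupport {θ : E → ℝ}
    (hθ : ContDiff ℝ (⊤ : ℕ∞) θ) (hc : HasCompactSupport θ) :
    Integrable (𝓕 fun x => (θ x : ℂ)) := by
  have hc' : HasCompactSupport fun x => (θ x : ℂ) := hc.comp_left (g := ((↑) : ℝ → ℂ)) rfl
  have hs : ContDiff ℝ (⊤ : ℕ∞) fun x => (θ x : ℂ) := Complex.ofRealCLM.contDiff.comp hθ
  have := (𝓕 (hc'.toSchwartzMap hs)).integrable (μ := volume)
  rw [SchwartzMap.fourier_coe] at this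
  exact this

omit [Nontrivial E] in
lemma integral_fourier_eq {θ : E → ℝ}
    (hθ : ContDiff ℝ (⊤ : ℕ∞) θ) (hc : HasCompactSupport θ) :
    ∫ ξ, 𝓕 (fun x => (θ x : ℂ)) ξ = θ 0 := by
  have hi : Integrable fun x => (θ x : ℂ) :=
    (hθ.continuous.integrable_of_hasCompactSupport hc).ofReal
  have := hi.fourierInv_fourier_eq (integrable_fourier_of_hasCompactSupport hθ hc) (v := 0)
    (Complex.continuous_ofReal.comp hθ.continuous).continuousAt
  rw [Real.fourierInv_eq] at this
  simpa using this

/-- The Riesz kernel `‖x‖ ^ (α - d)` is a fundamental solution of the singular integral operator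
`secondDiffIntegral α`, up to a negative multiplicative constant. -/
theorem exists_integral_rieszKernel_mul_secondDiffIntegral (h0 : 0 < α) (h2 : α < 2)
    (hα : α < Module.finrank ℝ E) :
    ∃ C, 0 < C ∧ ∀ θ : E → ℝ, ContDiff ℝ (⊤ : ℕ∞) θ → HasCompactSupport θ → ∀ y,
      ∫ x, ‖x - y‖ ^ (-((Module.finrank ℝ E : ℝ) - α)) * secondDiffIntegral α θ x =
        -C * θ y := by
  obtain ⟨K, hK, hm⟩ := exists_levySymbol_eq (E := E) h0 h2
  set d : ℝ := (Module.finrank ℝ E : ℝ)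
  have hG1 : 0 < Real.Gamma ((d - α) / 2) := Real.Gamma_pos_of_pos (by linarith)
  have hG2 : 0 < Real.Gamma (α / 2) := Real.Gamma_pos_of_pos (by linarith)
  set A : ℝ := π ^ (d / 2 - α) * Real.Gamma (α / 2)
  have hA : 0 < A := by positivity
  suffices H : ∀ θ : E → ℝ, ContDiff ℝ (⊤ : ℕ∞) θ → HasCompactSupport θ →
      ∫ x, ‖x‖ ^ (-(d - α)) * secondDiffIntegral α θ x =
        -(A * K / Real.Gamma ((d - α) / 2)) * θ 0 by
    refine ⟨A * K / Real.Gamma ((d - α) / 2), by positivity, fun θ hθ hc y => ?_⟩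
    have := H (fun x => θ (x + y)) (hθ.comp (contDiff_id.add contDiff_const))
      (hc.comp_homeomorph (Homeomorph.addRight y))
    simp only [secondDiffIntegral_comp_add_right, zero_add] at this
    rw [← this, ← integral_add_right_eq_self _ y]
    simp only [add_sub_cancel_right]
  intro θ hθ hc
  obtain ⟨M, hM⟩ := exists_abs_secondDiffIntegral_le h0 h2 hθ hc
  have hi := integrable_secondDiffIntegral h0 h2 hθ hc
  have hne : ∀ᵐ x : E, x ≠ 0 := by simp [ae_iff]
  have hF : ∀ ξ : E, ξ ≠ 0 → ((‖ξ‖ ^ (-α) : ℝ) : ℂ) *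
      𝓕 (fun x => (secondDiffIntegral α θ x : ℂ)) ξ = -(K : ℂ) * 𝓕 (fun x => (θ x : ℂ)) ξ := by
    intro ξ hξ
    have hp : 0 < ‖ξ‖ := norm_pos_iff.2 hξ
    have h1 : ‖ξ‖ ^ (-α) * ‖ξ‖ ^ α = 1 := by
      rw [← Real.rpow_add hp, neg_add_cancel, Real.rpow_zero]
    rw [fourier_secondDiffIntegral h0 h2 hθ hc, hm]
    push_cast
    have h1' : ((‖ξ‖ ^ (-α) : ℝ) : ℂ) * ((‖ξ‖ ^ α : ℝ) : ℂ) = 1 := by exact_mod_cast h1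
    linear_combination (-(K : ℂ) * 𝓕 (fun x => (θ x : ℂ)) ξ) * h1'
  have key := Gamma_mul_integral_norm_rpow_mul
    (g := fun x => (secondDiffIntegral α θ x : ℂ)) h0 hα hi.ofReal
    (by
      simp only [Complex.norm_real, Real.norm_eq_abs]
      exact integrable_norm_rpow_mul (by linarith) (by linarith) hi.abs
        (fun x => (abs_abs _).trans_le (hM x)))
    (by
      refine ((integrable_fourier_of_hasCompactSupport hθ hc).norm.const_mul K).congr ?_
      filter_upwards [hne] with ξ hξ
      have := congrArg norm (hF ξ hξ)
      rw [norm_mul, norm_mul, norm_neg, Complex.norm_real, Complex.norm_real,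
        Real.norm_of_nonneg hK.le, Real.norm_of_nonneg (by positivity)] at this
      exact this.symm)
  rw [integral_congr_ae (hne.mono hF), integral_const_mul, integral_fourier_eq hθ hc] at key
  simp only [← Complex.ofReal_mul] at key
  rw [integral_complex_ofReal] at key
  have key' : Real.Gamma ((d - α) / 2) * ∫ x, ‖x‖ ^ (-(d - α)) * secondDiffIntegral α θ x =
      A * (-K * θ 0) := by exact_mod_cast key
  rw [neg_mul, div_mul_eq_mul_div, ← neg_div, eq_div_iff hG1.ne']
  linarith

end RieszKernel

section RieszPotential

variable {E : Type*} [NormedAddCommGroup E] [InnerProductSpace ℝ E] [FiniteDimensional ℝ E]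
  [MeasurableSpace E] [BorelSpace E]

/-- The (unnormalised) Riesz potential `∫ ρ(y) ‖x - y‖^{-β} dy`. -/
def rieszPotential (β : ℝ) (ρ : E → ℝ) (x : E) : ℝ := ∫ y, ρ y * ‖x - y‖ ^ (-β)

variable {β : ℝ} {ρ : E → ℝ}

lemma rieszPotential_nonneg (hρ : ∀ x, 0 ≤ ρ x) (x : E) :
    0 ≤ rieszPotential β ρ x :=
  integral_nonneg fun y => mul_nonneg (hρ y) (by positivity)

lemma integral_rieszPotential_mul {S θ : E → ℝ} {C B : ℝ} (hρm : Measurable ρ)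
    (hρ : ∀ x, 0 ≤ ρ x) (hi : ∀ x, Integrable fun y => ρ y * ‖x - y‖ ^ (-β))
    (hcont : Continuous (rieszPotential β ρ)) (hB : ∀ x, rieszPotential β ρ x ≤ B)
    (hS : Integrable S) (hC : ∀ y, ∫ x, ‖x - y‖ ^ (-β) * S x = C * θ y) :
    ∫ x, rieszPotential β ρ x * S x = C * ∫ y, ρ y * θ y := by
  have hI : Integrable (Function.uncurry fun x y => ρ y * ‖x - y‖ ^ (-β) * S x)
      ((volume : Measure E).prod (volume : Measure E)) := by
    rw [integrable_prod_iff]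
    · refine ⟨Eventually.of_forall fun x => (hi x).mul_const (S x), ?_⟩
      refine (hS.norm.bdd_mul (c := B) hcont.aestronglyMeasurable
        (Eventually.of_forall fun x => ?_)).congr (Eventually.of_forall fun x => ?_)
      · rw [Real.norm_of_nonneg (rieszPotential_nonneg hρ x)]
        exact hB x
      · simp only [Function.uncurry, rieszPotential]
        rw [← integral_mul_const]
        congr 1 with y
        rw [norm_mul, Real.norm_of_nonneg (mul_nonneg (hρ y) (by positivity))]
    · refine AEStronglyMeasurable.mul (Measurable.aestronglyMeasurable ?_)
        hS.aestronglyMeasurable.comp_fst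
      exact (hρm.comp measurable_snd).mul ((measurable_fst.sub measurable_snd).norm.pow_const _)
  simp only [rieszPotential, ← integral_mul_const]
  rw [integral_integral_swap hI, ← integral_const_mul]
  congr 1 with y
  simp only [mul_assoc]
  rw [integral_const_mul, hC]
  ring

variable [Nontrivial E]

lemma integrable_mul_norm_sub_rpow (hβ0 : 0 ≤ β) (hβ : β < Module.finrank ℝ E) (hi : Integrable ρ)
    {M : ℝ} (hM : ∀ x, |ρ x| ≤ M) (x : E) : Integrable fun y => ρ y * ‖x - y‖ ^ (-β) := by
  have := (integrable_norm_rpow_mul hβ0 hβ (hi.comp_sub_left x) fun y => hM (x - y)).comp_sub_left x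
  simpa only [sub_sub_cancel, mul_comm] using this

lemma rieszPotential_le (hβ0 : 0 ≤ β) (hβ : β < Module.finrank ℝ E) (hi : Integrable ρ)
    (hρ : ∀ x, 0 ≤ ρ x) {M : ℝ} (hM : ∀ x, ρ x ≤ M) (x : E) :
    rieszPotential β ρ x ≤ M * (∫ z in Metric.ball (0 : E) 1, ‖z‖ ^ (-β)) + ∫ y, ρ y := by
  set k : E → ℝ := (Metric.ball (0 : E) 1).indicator fun z => ‖z‖ ^ (-β)
  have hk : Integrable k := (integrable_indicator_iff Metric.isOpen_ball.measurableSet).2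
    (integrableOn_ball_norm_rpow volume hβ 1)
  have hle : ∀ y, ρ y * ‖x - y‖ ^ (-β) ≤ M * k (x - y) + ρ y := by
    intro y
    have hp : 0 ≤ ‖x - y‖ ^ (-β) := by positivity
    by_cases hy : x - y ∈ Metric.ball (0 : E) 1
    · simp only [k, Set.indicator_of_mem hy]
      nlinarith [hM y, hρ y]
    · simp only [k, Set.indicator_of_notMem hy]
      rw [mem_ball_zero_iff, not_lt] at hy
      have := Real.rpow_le_one_of_one_le_of_nonpos hy (by linarith : -β ≤ 0)
      nlinarith [hρ y]
  have hM' : ∀ x, |ρ x| ≤ M := fun x => by rw [abs_of_nonneg (hρ x)]; exact hM x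
  have hsum : Integrable fun y => M * k (x - y) + ρ y := ((hk.comp_sub_left x).const_mul M).add hi
  refine (integral_mono (integrable_mul_norm_sub_rpow hβ0 hβ hi hM' x) hsum hle).trans
    (le_of_eq ?_)
  rw [integral_add ((hk.comp_sub_left x).const_mul M) hi, integral_const_mul,
    integral_sub_left_eq_self k, integral_indicator Metric.isOpen_ball.measurableSet]

lemma tendsto_rieszPotential_cocompact (hβ0 : 0 < β) (hβ : β < Module.finrank ℝ E)
    (hi : Integrable ρ) (hρ : ∀ x, 0 ≤ ρ x) {M : ℝ} (hM : ∀ x, ρ x ≤ M) {R : ℝ}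
    (hR : ∀ x, R < ‖x‖ → ρ x = 0) : Tendsto (rieszPotential β ρ) (cocompact E) (𝓝 0) := by
  have hM' : ∀ x, |ρ x| ≤ M := fun x => by rw [abs_of_nonneg (hρ x)]; exact hM x
  have hn : Tendsto (fun x : E => ‖x‖ - R) (cocompact E) atTop :=
    tendsto_atTop_add_const_right _ (-R) (tendsto_norm_cocompact_atTop)
  have hlim : Tendsto (fun x : E => (∫ y, ρ y) * (‖x‖ - R) ^ (-β)) (cocompact E) (𝓝 0) := by
    simpa using ((tendsto_rpow_neg_atTop hβ0).comp hn).const_mul (∫ y, ρ y)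
  refine squeeze_zero' (Eventually.of_forall fun x => rieszPotential_nonneg hρ x) ?_ hlim
  filter_upwards [hn.eventually_gt_atTop 0] with x hx
  rw [← integral_mul_const]
  refine integral_mono (integrable_mul_norm_sub_rpow hβ0.le hβ hi hM' x) (hi.mul_const _)
    fun y => ?_
  rcases lt_or_ge R ‖y‖ with hy | hy
  · simp [hR y hy]
  · refine mul_le_mul_of_nonneg_left ?_ (hρ y)
    refine Real.rpow_le_rpow_of_nonpos hx ?_ (by linarith)
    linarith [norm_sub_norm_le x y]

lemma tendsto_integral_ball_norm_rpow (hβ : β < Module.finrank ℝ E) :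
    Tendsto (fun n : ℕ => ∫ z in Metric.ball (0 : E) (1 / ((n : ℝ) + 1)), ‖z‖ ^ (-β))
      atTop (𝓝 0) := by
  have hset : ⋂ n : ℕ, Metric.ball (0 : E) (1 / ((n : ℝ) + 1)) = {0} := by
    ext z
    simp only [Set.mem_iInter, mem_ball_zero_iff, Set.mem_singleton_iff]
    refine ⟨fun h => ?_, fun h n => ?_⟩
    · have := ge_of_tendsto' tendsto_one_div_add_atTop_nhds_zero_nat fun n => (h n).le
      exact norm_le_zero_iff.1 this
    · rw [h, norm_zero]
      positivity
  have := tendsto_setIntegral_of_antitone (μ := (volume : Measure E)) (f := fun z => ‖z‖ ^ (-β))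
    (s := fun n : ℕ => Metric.ball (0 : E) (1 / ((n : ℝ) + 1)))
    (fun n => Metric.isOpen_ball.measurableSet)
    (fun m n h => Metric.ball_subset_ball (Nat.one_div_le_one_div h))
    ⟨0, integrableOn_ball_norm_rpow volume hβ _⟩
  rw [hset] at this
  simpa using this

lemma continuous_integral_mul_max_norm_sub_rpow (hβ0 : 0 < β) (hρm : Measurable ρ)
    (hρ : ∀ x, 0 ≤ ρ x) (hi : ∀ x, Integrable fun y => ρ y * ‖x - y‖ ^ (-β)) {δ : ℝ} (hδ : 0 < δ) :
    Continuous fun x => ∫ y, ρ y * (max ‖x - y‖ δ) ^ (-β) := by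
  rw [continuous_iff_continuousAt]
  intro x₀
  refine continuousAt_of_dominated (bound := fun y => 2 ^ β * (ρ y * ‖x₀ - y‖ ^ (-β))) ?_ ?_
    ((hi x₀).const_mul _) ?_
  · exact Eventually.of_forall fun x => Measurable.aestronglyMeasurable
      (hρm.mul (((measurable_const.sub measurable_id).norm.max measurable_const).pow_const _))
  · filter_upwards [Metric.ball_mem_nhds x₀ hδ] with x hx
    have hne : ∀ᵐ y : E, y ≠ x₀ := by simp [ae_iff]
    filter_upwards [hne] with y hy
    have hp : 0 < ‖x₀ - y‖ := norm_pos_iff.2 (sub_ne_zero.2 hy.symm)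
    have hm : 0 < max ‖x - y‖ δ := lt_max_of_lt_right hδ
    rw [Real.norm_of_nonneg (mul_nonneg (hρ y) (by positivity)), mul_left_comm]
    refine mul_le_mul_of_nonneg_left ?_ (hρ y)
    have h1 : ‖x₀ - y‖ / 2 ≤ max ‖x - y‖ δ := by
      rw [mem_ball_iff_norm'] at hx
      have h2 := norm_add_le (x₀ - x) (x - y)
      rw [sub_add_sub_cancel] at h2
      linarith [le_max_left ‖x - y‖ δ, le_max_right ‖x - y‖ δ]
    refine (Real.rpow_le_rpow_of_nonpos (by positivity) h1 (by linarith)).trans (le_of_eq ?_)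
    rw [Real.div_rpow hp.le zero_le_two, Real.rpow_neg zero_le_two, div_inv_eq_mul, mul_comm]
  · refine Eventually.of_forall fun y => ?_
    refine continuousAt_const.mul (ContinuousAt.rpow_const (by fun_prop) (Or.inl ?_))
    exact (lt_max_of_lt_right hδ).ne'

lemma abs_rieszPotential_sub_le (hβ0 : 0 < β) (hβ : β < Module.finrank ℝ E) (hρm : Measurable ρ)
    (hρ : ∀ x, 0 ≤ ρ x) {x : E} (hi : Integrable fun y => ρ y * ‖x - y‖ ^ (-β))
    {δ : ℝ} (hδ : 0 < δ) {M : ℝ} (hM : ∀ y, ‖x - y‖ < δ → ρ y ≤ M) :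
    |rieszPotential β ρ x - ∫ y, ρ y * (max ‖x - y‖ δ) ^ (-β)| ≤
      M * ∫ z in Metric.ball (0 : E) δ, ‖z‖ ^ (-β) := by
  set k : E → ℝ := (Metric.ball (0 : E) δ).indicator fun z => ‖z‖ ^ (-β)
  have hk : Integrable k := (integrable_indicator_iff Metric.isOpen_ball.measurableSet).2
    (integrableOn_ball_norm_rpow volume hβ δ)
  have hne : ∀ᵐ y : E, y ≠ x := by simp [ae_iff]
  have hmax : ∀ y, y ≠ x → (max ‖x - y‖ δ) ^ (-β) ≤ ‖x - y‖ ^ (-β) := fun y hy =>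
    Real.rpow_le_rpow_of_nonpos (norm_pos_iff.2 (sub_ne_zero.2 hy.symm)) (le_max_left _ _)
      (by linarith)
  have hi' : Integrable fun y => ρ y * (max ‖x - y‖ δ) ^ (-β) := by
    refine hi.mono' (Measurable.aestronglyMeasurable
      (hρm.mul (((measurable_const.sub measurable_id).norm.max measurable_const).pow_const _))) ?_
    filter_upwards [hne] with y hy
    rw [Real.norm_of_nonneg (mul_nonneg (hρ y) (by positivity))]
    exact mul_le_mul_of_nonneg_left (hmax y hy) (hρ y)
  have hk' : ∫ y, M * k (x - y) = M * ∫ z in Metric.ball (0 : E) δ, ‖z‖ ^ (-β) := by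
    rw [integral_const_mul, integral_sub_left_eq_self k,
      integral_indicator Metric.isOpen_ball.measurableSet]
  rw [rieszPotential, ← integral_sub hi hi', ← hk', ← Real.norm_eq_abs]
  refine norm_integral_le_of_norm_le ((hk.comp_sub_left x).const_mul M) ?_
  filter_upwards [hne] with y hy
  rw [← mul_sub, Real.norm_of_nonneg (mul_nonneg (hρ y) (sub_nonneg.2 (hmax y hy)))]
  by_cases hy' : x - y ∈ Metric.ball (0 : E) δ
  · simp only [k, Set.indicator_of_mem hy']
    have hd : ‖x - y‖ < δ := by simpa using hy'
    have : 0 ≤ (max ‖x - y‖ δ) ^ (-β) := by positivity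
    exact mul_le_mul (hM y hd) (by linarith) (sub_nonneg.2 (hmax y hy)) ((hρ y).trans (hM y hd))
  · simp only [k, Set.indicator_of_notMem hy']
    rw [mem_ball_zero_iff, not_lt] at hy'
    rw [max_eq_left hy']
    simp

lemma continuous_rieszPotential (hβ0 : 0 < β) (hβ : β < Module.finrank ℝ E) (hρm : Measurable ρ)
    (hρ : ∀ x, 0 ≤ ρ x) (hlb : ∀ R : ℝ, ∃ M : ℝ, ∀ x : E, ‖x‖ ≤ R → ρ x ≤ M)
    (hi : ∀ x, Integrable fun y => ρ y * ‖x - y‖ ^ (-β)) : Continuous (rieszPotential β ρ) := by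
  rw [continuous_iff_continuousAt]
  intro x₀
  refine continuousAt_of_locally_uniform_approx_of_continuousAt fun u hu => ?_
  obtain ⟨ε, hε, hεu⟩ := Metric.mem_uniformity_dist.1 hu
  obtain ⟨M, hM⟩ := hlb (‖x₀‖ + 2)
  have hlim := (tendsto_integral_ball_norm_rpow (E := E) hβ).const_mul M
  rw [mul_zero] at hlim
  obtain ⟨n, hn⟩ := (hlim.eventually_lt_const hε).exists
  have hδ : 0 < 1 / ((n : ℝ) + 1) := by positivity
  have hδ1 : 1 / ((n : ℝ) + 1) ≤ 1 := by
    rw [div_le_one (by positivity)]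
    linarith [(Nat.cast_nonneg n : (0 : ℝ) ≤ n)]
  refine ⟨Metric.ball x₀ 1, Metric.ball_mem_nhds x₀ one_pos, _,
    (continuous_integral_mul_max_norm_sub_rpow hβ0 hρm hρ hi hδ).continuousAt, fun x hx => ?_⟩
  refine hεu ?_
  rw [Real.dist_eq]
  refine (abs_rieszPotential_sub_le hβ0 hβ hρm hρ (hi x) hδ fun y hy => hM y ?_).trans_lt hn
  rw [mem_ball_iff_norm] at hx
  have h1 : y = x₀ + (x - x₀) - (x - y) := by abel
  calc ‖y‖ = ‖x₀ + (x - x₀) - (x - y)‖ := by rw [← h1]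
    _ ≤ ‖x₀‖ + ‖x - x₀‖ + ‖x - y‖ := (norm_sub_le _ _).trans (by gcongr; exact norm_add_le _ _)
    _ ≤ _ := by linarith

end RieszPotential

section MaximumPrinciple

variable {E : Type*} [NormedAddCommGroup E] [InnerProductSpace ℝ E] [FiniteDimensional ℝ E]
  [MeasurableSpace E] [BorelSpace E] {α : ℝ}

lemma continuous_integral_add_mul {w φ : E → ℝ} {B : ℝ} (hw : Continuous w) (hB : ∀ x, |w x| ≤ B)
    (hφ : Integrable φ) : Continuous fun x => ∫ y, w (x + y) * φ y := by
  refine continuous_of_dominated (bound := fun y => B * |φ y|) (fun x => ?_) (fun x => ?_)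
    (hφ.abs.const_mul B) (Eventually.of_forall fun y => by fun_prop)
  · exact (hw.comp (continuous_const.add continuous_id)).aestronglyMeasurable.mul
      hφ.aestronglyMeasurable
  · refine Eventually.of_forall fun y => ?_
    rw [norm_mul, Real.norm_eq_abs, Real.norm_eq_abs]
    exact mul_le_mul_of_nonneg_right (hB _) (abs_nonneg _)

lemma integral_mul_secondDiff {w φ : E → ℝ} {B : ℝ} (hw : Continuous w) (hB : ∀ x, |w x| ≤ B)
    (hφ : Integrable φ) (x₀ z : E) :
    ∫ x, w x * secondDiff (fun y => φ (y - x₀)) x z =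
      secondDiff (fun x => ∫ y, w (x + y) * φ y) x₀ z := by
  have hi : ∀ a : E, Integrable fun x => w x * φ (x - a) := fun a =>
    (hφ.comp_sub_right a).bdd_mul (c := B) hw.aestronglyMeasurable (Eventually.of_forall hB)
  have ht : ∀ a : E, ∫ x, w x * φ (x - a) = ∫ y, w (a + y) * φ y := fun a => by
    rw [← integral_add_left_eq_self _ a]
    simp
  have h : ∀ x, w x * secondDiff (fun y => φ (y - x₀)) x z =
      w x * φ (x - (x₀ - z)) + w x * φ (x - (x₀ + z)) - 2 * (w x * φ (x - x₀)) := by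
    intro x
    have h1 : x + z - x₀ = x - (x₀ - z) := by abel
    have h2 : x - z - x₀ = x - (x₀ + z) := by abel
    simp only [secondDiff, h1, h2]
    ring
  simp only [h]
  have hs : Integrable fun x => w x * φ (x - (x₀ - z)) + w x * φ (x - (x₀ + z)) :=
    (hi _).add (hi _)
  rw [integral_sub hs ((hi _).const_mul 2), integral_add (hi _) (hi _), integral_const_mul, ht, ht,
    ht]
  simp only [secondDiff]
  ring

omit [InnerProductSpace ℝ E] [FiniteDimensional ℝ E] [MeasurableSpace E] [BorelSpace E] in
lemma HasCompactSupport.comp_sub_right {φ : E → ℝ} (hc : HasCompactSupport φ) (x₀ : E) :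
    HasCompactSupport fun y => φ (y - x₀) :=
  hc.comp_homeomorph (Homeomorph.subRight x₀)

variable [Nontrivial E]

lemma integral_mul_secondDiffIntegral (h0 : 0 < α) (h2 : α < 2) {w φ : E → ℝ} {B : ℝ}
    (hw : Continuous w) (hB : ∀ x, |w x| ≤ B) (hφ : ContDiff ℝ (⊤ : ℕ∞) φ)
    (hc : HasCompactSupport φ) (x₀ : E) :
    Integrable (fun z => secondDiff (fun x => ∫ y, w (x + y) * φ y) x₀ z /
        ‖z‖ ^ ((Module.finrank ℝ E : ℝ) + α)) ∧
      ∫ x, w x * secondDiffIntegral α (fun y => φ (y - x₀)) x =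
        secondDiffIntegral α (fun x => ∫ y, w (x + y) * φ y) x₀ := by
  have hφi : Integrable φ := hφ.continuous.integrable_of_hasCompactSupport hc
  have hθ : ContDiff ℝ (⊤ : ℕ∞) fun y => φ (y - x₀) := hφ.comp (contDiff_id.sub contDiff_const)
  have hθc : HasCompactSupport fun y => φ (y - x₀) := hc.comp_sub_right x₀
  have hP : Integrable (Function.uncurry fun x z : E => w x *
      (secondDiff (fun y => φ (y - x₀)) x z / ‖z‖ ^ ((Module.finrank ℝ E : ℝ) + α)))
      ((volume : Measure E).prod (volume : Measure E)) :=
    (integrable_prod_secondDiff h0 h2 hθ hθc).bdd_mul (c := B)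
      hw.aestronglyMeasurable.comp_fst (Eventually.of_forall fun p => hB p.1)
  have h : ∀ z, ∫ x, w x *
      (secondDiff (fun y => φ (y - x₀)) x z / ‖z‖ ^ ((Module.finrank ℝ E : ℝ) + α)) =
      secondDiff (fun x => ∫ y, w (x + y) * φ y) x₀ z /
        ‖z‖ ^ ((Module.finrank ℝ E : ℝ) + α) := fun z => by
    simp only [← mul_div_assoc]
    rw [integral_div, integral_mul_secondDiff hw hB hφi]
  refine ⟨?_, ?_⟩
  · simpa only [Function.uncurry, h] using hP.integral_prod_right
  · simp only [secondDiffIntegral, ← integral_const_mul]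
    rw [integral_integral_swap hP]
    simp only [h]

/-- A continuous function attaining its minimum at `x₀` and exceeding it far away has positive
singular integral at `x₀`. -/
lemma secondDiffIntegral_pos {W : E → ℝ} {x₀ : E} (hmin : ∀ y, W x₀ ≤ W y)
    (hlt : ∀ᶠ y in cocompact E, W x₀ < W y)
    (hi : Integrable fun z => secondDiff W x₀ z / ‖z‖ ^ ((Module.finrank ℝ E : ℝ) + α)) :
    0 < secondDiffIntegral α W x₀ := by
  have hnn : ∀ z, 0 ≤ secondDiff W x₀ z / ‖z‖ ^ ((Module.finrank ℝ E : ℝ) + α) := fun z => by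
    refine div_nonneg ?_ (by positivity)
    simp only [secondDiff]
    linarith [hmin (x₀ + z), hmin (x₀ - z)]
  rw [secondDiffIntegral, integral_pos_iff_support_of_nonneg hnn hi]
  rw [← Metric.cobounded_eq_cocompact, hasBasis_cobounded_norm.eventually_iff] at hlt
  obtain ⟨R, -, hR⟩ := hlt
  set r := max 0 (R + ‖x₀‖)
  have hopen : IsOpen {z : E | r < ‖z‖} := isOpen_lt continuous_const continuous_norm
  refine (hopen.measure_pos volume (NormedSpace.exists_lt_norm ℝ E r)).trans_le (measure_mono ?_)
  intro z hz
  have hz' : r < ‖z‖ := hz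
  have hz0 : 0 < ‖z‖ := (le_max_left _ _).trans_lt hz'
  have hzR : R + ‖x₀‖ < ‖z‖ := (le_max_right _ _).trans_lt hz'
  have h1 : W x₀ < W (x₀ + z) := hR (show R ≤ ‖x₀ + z‖ by
    have := norm_sub_le (x₀ + z) x₀
    rw [add_sub_cancel_left] at this
    linarith)
  refine (div_pos ?_ (Real.rpow_pos_of_pos hz0 _)).ne'
  simp only [secondDiff]
  linarith [hmin (x₀ - z)]

/-- Distributional maximum principle for the fractional Laplacian. -/
theorem le_of_integral_mul_secondDiffIntegral_nonpos (h0 : 0 < α) (h2 : α < 2) {w : E → ℝ}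
    {B m : ℝ} (hw : Continuous w) (hB : ∀ x, |w x| ≤ B)
    (hsuper : ∀ θ : E → ℝ, ContDiff ℝ (⊤ : ℕ∞) θ → HasCompactSupport θ → (∀ x, 0 ≤ θ x) →
      ∫ x, w x * secondDiffIntegral α θ x ≤ 0)
    (hm : ∀ ε > 0, ∀ᶠ x in cocompact E, m - ε ≤ w x) (x : E) : m ≤ w x := by
  by_contra! hx
  obtain ⟨m', hxm', hm'⟩ := exists_between hx
  obtain ⟨r, hr, hball⟩ := Metric.eventually_nhds_iff_ball.1
    (hw.continuousAt.eventually_lt_const hxm')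
  let f : ContDiffBump (0 : E) := ⟨r / 2, r, by positivity, by linarith⟩
  set φ : E → ℝ := f.normed volume
  have hφ : ContDiff ℝ (⊤ : ℕ∞) φ := f.contDiff_normed
  have hφc : HasCompactSupport φ := f.hasCompactSupport_normed
  have hφ0 : ∀ y, 0 ≤ φ y := f.nonneg_normed
  have hφ1 : ∫ y, φ y = 1 := f.integral_normed
  have hφi : Integrable φ := hφ.continuous.integrable_of_hasCompactSupport hφc
  have hφr : ∀ y, φ y ≠ 0 → ‖y‖ < r := fun y hy => by
    have : y ∈ Function.support φ := hy
    rwa [f.support_normed_eq, mem_ball_zero_iff] at this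
  set W : E → ℝ := fun x => ∫ y, w (x + y) * φ y
  have hW : Continuous W := continuous_integral_add_mul hw hB hφi
  have hWi : ∀ a, Integrable fun y => w (a + y) * φ y := fun a =>
    hφi.bdd_mul (c := B) (hw.comp (continuous_const.add continuous_id)).aestronglyMeasurable
      (Eventually.of_forall fun y => hB _)
  have hWx : W x ≤ m' := by
    refine (integral_mono (hWi x) (hφi.const_mul m') fun y => ?_).trans (le_of_eq ?_)
    · by_cases hy : φ y = 0
      · simp [hy]
      · exact mul_le_mul_of_nonneg_right
          (hball _ (by simpa using hφr y hy)).le (hφ0 y)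
    · rw [integral_const_mul, hφ1, mul_one]
  have hWinf : ∀ᶠ a in cocompact E, m' < W a := by
    have h := hm ((m - m') / 2) (by linarith)
    rw [← Metric.cobounded_eq_cocompact, hasBasis_cobounded_norm.eventually_iff] at h ⊢
    obtain ⟨R, -, hR⟩ := h
    refine ⟨R + r, trivial, fun a ha => ?_⟩
    have ha' : R + r ≤ ‖a‖ := ha
    have : m - (m - m') / 2 ≤ W a := by
      refine (le_of_eq ?_).trans (integral_mono (hφi.const_mul (m - (m - m') / 2)) (hWi a)
        fun y => ?_)
      · rw [integral_const_mul, hφ1, mul_one]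
      · by_cases hy : φ y = 0
        · simp [hy]
        · refine mul_le_mul_of_nonneg_right (hR (show R ≤ ‖a + y‖ from ?_)) (hφ0 y)
          have h1 := norm_sub_le (a + y) y
          rw [add_sub_cancel_right] at h1
          linarith [hφr y hy]
    linarith
  obtain ⟨x₀, hx₀⟩ := hW.exists_forall_le' x (hWinf.mono fun a ha => hWx.trans ha.le)
  obtain ⟨h_int, heq⟩ := integral_mul_secondDiffIntegral h0 h2 hw hB hφ hφc x₀
  have hpos := secondDiffIntegral_pos hx₀
    (hWinf.mono fun a ha => ((hx₀ x).trans hWx).trans_lt ha) h_int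
  rw [← heq] at hpos
  refine hpos.not_ge (hsuper _ (hφ.comp (contDiff_id.sub contDiff_const))
    (hφc.comp_sub_right x₀) fun y => hφ0 _)

end MaximumPrinciple

section BoundedSolutions

variable {E : Type*} [NormedAddCommGroup E] [InnerProductSpace ℝ E] [FiniteDimensional ℝ E]
  [MeasurableSpace E] [BorelSpace E] {α : ℝ} {ρ : E → ℝ}

lemma integrable_mul_of_hasCompactSupport (hρm : Measurable ρ) (hρ : ∀ x, 0 ≤ ρ x)
    (hlb : ∀ R : ℝ, ∃ M : ℝ, ∀ x : E, ‖x‖ ≤ R → ρ x ≤ M) {θ : E → ℝ} (hθ : Continuous θ)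
    (hc : HasCompactSupport θ) : Integrable fun x => ρ x * θ x := by
  obtain ⟨R, hR⟩ := hc.isCompact.isBounded.exists_norm_le
  obtain ⟨M, hM⟩ := hlb R
  refine ((hθ.integrable_of_hasCompactSupport hc).abs.const_mul M).mono'
    (hρm.mul hθ.measurable).aestronglyMeasurable (Eventually.of_forall fun x => ?_)
  rw [norm_mul, Real.norm_of_nonneg (hρ x), Real.norm_eq_abs]
  by_cases hx : θ x = 0
  · simp [hx]
  · exact mul_le_mul_of_nonneg_right (hM x (hR x (subset_tsupport θ hx))) (abs_nonneg _)

variable [Nontrivial E]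

lemma rieszPotential_indicator_le (h0 : 0 < α) (h2 : α < 2) (hα : α < Module.finrank ℝ E)
    {C : ℝ} (hC0 : 0 < C) (hC : ∀ θ : E → ℝ, ContDiff ℝ (⊤ : ℕ∞) θ → HasCompactSupport θ → ∀ y,
      ∫ x, ‖x - y‖ ^ (-((Module.finrank ℝ E : ℝ) - α)) * secondDiffIntegral α θ x = -C * θ y)
    (hρm : Measurable ρ) (hρ : ∀ x, 0 ≤ ρ x)
    (hlb : ∀ R : ℝ, ∃ M : ℝ, ∀ x : E, ‖x‖ ≤ R → ρ x ≤ M) {u : E → ℝ} {M b : ℝ}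
    (hu : Continuous u) (hM : ∀ x, |u x| ≤ M) (hb : 0 < b)
    (hsol : ∀ θ : E → ℝ, ContDiff ℝ (⊤ : ℕ∞) θ → HasCompactSupport θ →
      ∫ x, u x * secondDiffIntegral α θ x = -b * ∫ x, ρ x * θ x) (R : ℝ) :
    (∀ x, Integrable fun y => (Metric.closedBall (0 : E) R).indicator ρ y *
        ‖x - y‖ ^ (-((Module.finrank ℝ E : ℝ) - α))) ∧
      ∀ x, rieszPotential ((Module.finrank ℝ E : ℝ) - α)
        ((Metric.closedBall (0 : E) R).indicator ρ) x ≤ 2 * M * C / b := by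
  set β : ℝ := (Module.finrank ℝ E : ℝ) - α
  have hβ0 : 0 < β := sub_pos.2 hα
  have hβ : β < Module.finrank ℝ E := sub_lt_self _ h0
  set ρR : E → ℝ := (Metric.closedBall (0 : E) R).indicator ρ
  have hρRm : Measurable ρR := hρm.indicator Metric.isClosed_closedBall.measurableSet
  have hρR : ∀ x, 0 ≤ ρR x := Set.indicator_nonneg fun x _ => hρ x
  have hρRle : ∀ x, ρR x ≤ ρ x := Set.indicator_le_self' fun x _ => hρ x
  have hρR0 : ∀ x, R < ‖x‖ → ρR x = 0 := fun x hx =>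
    Set.indicator_of_notMem (by simpa using hx) _
  obtain ⟨K, hK⟩ : ∃ K, ∀ x, ρR x ≤ K := by
    obtain ⟨K, hK⟩ := hlb R
    refine ⟨max K 0, fun x => ?_⟩
    rcases lt_or_ge R ‖x‖ with hx | hx
    · rw [hρR0 x hx]
      exact le_max_right _ _
    · exact (hρRle x).trans ((hK x hx).trans (le_max_left _ _))
  have hρRabs : ∀ x, |ρR x| ≤ K := fun x => by rw [abs_of_nonneg (hρR x)]; exact hK x
  have hρRi : Integrable ρR := by
    rw [← integrableOn_iff_integrable_of_support_subset (s := Metric.closedBall (0 : E) R)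
      Set.support_indicator_subset]
    exact Measure.integrableOn_of_bounded measure_closedBall_lt_top.ne hρRm.aestronglyMeasurable
      (Eventually.of_forall hρRabs)
  have hi : ∀ x, Integrable fun y => ρR y * ‖x - y‖ ^ (-β) :=
    integrable_mul_norm_sub_rpow hβ0.le hβ hρRi hρRabs
  refine ⟨hi, ?_⟩
  have hPc : Continuous (rieszPotential β ρR) :=
    continuous_rieszPotential hβ0 hβ hρRm hρR (fun _ => ⟨K, fun x _ => hK x⟩) hi
  set B := K * (∫ z in Metric.ball (0 : E) 1, ‖z‖ ^ (-β)) + ∫ y, ρR y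
  have hPB : ∀ x, rieszPotential β ρR x ≤ B := rieszPotential_le hβ0.le hβ hρRi hρR hK
  have hPabs : ∀ x, |rieszPotential β ρR x| ≤ B := fun x => by
    rw [abs_of_nonneg (rieszPotential_nonneg hρR x)]
    exact hPB x
  have hbC : 0 < b / C := by positivity
  have hwB : ∀ x, |u x - b / C * rieszPotential β ρR x| ≤ M + b / C * B := fun x => by
    refine (abs_sub _ _).trans (add_le_add (hM x) ?_)
    rw [abs_mul, abs_of_pos hbC]
    exact mul_le_mul_of_nonneg_left (hPabs x) hbC.le
  have hmax := le_of_integral_mul_secondDiffIntegral_nonpos h0 h2 (m := -M)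
    (w := fun x => u x - b / C * rieszPotential β ρR x) (hu.sub (continuous_const.mul hPc)) hwB
    (fun θ hθ hc hθ0 => ?_) (fun ε hε => ?_)
  · intro x
    have h1 := hmax x
    have h2 := (abs_le.1 (hM x)).2
    rw [le_div_iff₀ hb]
    have h3 : b / C * rieszPotential β ρR x ≤ 2 * M := by linarith
    rw [div_mul_eq_mul_div, div_le_iff₀ hC0] at h3
    linarith
  · have hS := integrable_secondDiffIntegral h0 h2 hθ hc
    have hP := integral_rieszPotential_mul (θ := θ) hρRm hρR hi hPc hPB hS (hC θ hθ hc)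
    have hi1 : Integrable fun x => u x * secondDiffIntegral α θ x :=
      hS.bdd_mul (c := M) hu.aestronglyMeasurable (Eventually.of_forall hM)
    have hi2 : Integrable fun x => rieszPotential β ρR x * secondDiffIntegral α θ x :=
      hS.bdd_mul (c := B) hPc.aestronglyMeasurable (Eventually.of_forall hPabs)
    simp only [sub_mul, mul_assoc]
    rw [integral_sub hi1 (hi2.const_mul _), integral_const_mul, hsol θ hθ hc, hP]
    have hle : ∫ x, ρR x * θ x ≤ ∫ x, ρ x * θ x :=
      integral_mono_of_nonneg (Eventually.of_forall fun x => mul_nonneg (hρR x) (hθ0 x))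
        (integrable_mul_of_hasCompactSupport hρm hρ hlb hθ.continuous hc)
        (Eventually.of_forall fun x => mul_le_mul_of_nonneg_right (hρRle x) (hθ0 x))
    have hcancel : b / C * (-C * ∫ x, ρR x * θ x) = -(b * ∫ x, ρR x * θ x) := by
      field_simp
    rw [hcancel]
    nlinarith
  · have hlim := (tendsto_rieszPotential_cocompact hβ0 hβ hρRi hρR hK hρR0).const_mul (b / C)
    rw [mul_zero] at hlim
    filter_upwards [hlim.eventually_lt_const hε] with x hx
    linarith [(abs_le.1 (hM x)).1]

theorem exists_bounded_solution_iff (h0 : 0 < α) (h2 : α < 2) (hα : α < Module.finrank ℝ E)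
    {a : ℝ} (ha : 0 < a) (hρm : Measurable ρ) (hρ : ∀ x, 0 ≤ ρ x)
    (hlb : ∀ R : ℝ, ∃ M : ℝ, ∀ x : E, ‖x‖ ≤ R → ρ x ≤ M) :
    (∃ u : E → ℝ, Continuous u ∧ (∃ M, ∀ x, |u x| ≤ M) ∧
      ∀ θ : E → ℝ, ContDiff ℝ (⊤ : ℕ∞) θ → HasCompactSupport θ →
        ∫ x, u x * (a * secondDiffIntegral α θ x) = -∫ x, ρ x * θ x) ↔
    (⨆ x : E, ∫⁻ y, ENNReal.ofReal (ρ y * ‖x - y‖ ^ (-((Module.finrank ℝ E : ℝ) - α)))) < ⊤ := by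
  obtain ⟨C, hC0, hC⟩ := exists_integral_rieszKernel_mul_secondDiffIntegral (E := E) h0 h2 hα
  constructor
  · rintro ⟨u, hu, ⟨M, hM⟩, hsol⟩
    have hsol' : ∀ θ : E → ℝ, ContDiff ℝ (⊤ : ℕ∞) θ → HasCompactSupport θ →
        ∫ x, u x * secondDiffIntegral α θ x = -a⁻¹ * ∫ x, ρ x * θ x := by
      intro θ hθ hc
      have h := hsol θ hθ hc
      simp only [mul_left_comm _ a] at h
      rw [integral_const_mul] at h
      rw [neg_mul, ← mul_neg, ← h, inv_mul_cancel_left₀ ha.ne']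
    refine (iSup_le fun x => ?_).trans_lt (ENNReal.ofReal_lt_top (r := 2 * M * C / a⁻¹))
    rw [← setLIntegral_univ, ← Metric.iUnion_closedBall_nat (0 : E),
      setLIntegral_iUnion_of_directed _ (Monotone.directed_le fun m n h =>
        Metric.closedBall_subset_closedBall (Nat.cast_le.2 h))]
    refine iSup_le fun n => ?_
    obtain ⟨hi, hle⟩ := rieszPotential_indicator_le h0 h2 hα hC0 hC hρm hρ hlb hu hM
      (inv_pos.2 ha) hsol' n
    refine le_trans (le_of_eq ?_) (ENNReal.ofReal_le_ofReal (hle x))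
    rw [rieszPotential, ofReal_integral_eq_lintegral_ofReal (hi x) (Eventually.of_forall fun y =>
      mul_nonneg (Set.indicator_nonneg (fun x _ => hρ x) y) (by positivity)),
      ← lintegral_indicator Metric.isClosed_closedBall.measurableSet]
    congr 1 with y
    by_cases hy : y ∈ Metric.closedBall (0 : E) n <;> simp [hy]
  · intro hfin
    set β : ℝ := (Module.finrank ℝ E : ℝ) - α
    set V := ⨆ x : E, ∫⁻ y, ENNReal.ofReal (ρ y * ‖x - y‖ ^ (-β))
    have hV : ∀ x, ∫⁻ y, ENNReal.ofReal (ρ y * ‖x - y‖ ^ (-β)) ≤ V :=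
      le_iSup fun x => ∫⁻ y, ENNReal.ofReal (ρ y * ‖x - y‖ ^ (-β))
    have hnn : ∀ x y, 0 ≤ ρ y * ‖x - y‖ ^ (-β) := fun x y => mul_nonneg (hρ y) (by positivity)
    have hm : ∀ x, AEStronglyMeasurable fun y => ρ y * ‖x - y‖ ^ (-β) := fun x =>
      (hρm.mul ((measurable_const.sub measurable_id).norm.pow_const _)).aestronglyMeasurable
    have hi : ∀ x, Integrable fun y => ρ y * ‖x - y‖ ^ (-β) := fun x =>
      (lintegral_ofReal_ne_top_iff_integrable (hm x) (Eventually.of_forall (hnn x))).1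
        ((hV x).trans_lt hfin).ne
    have hPc : Continuous (rieszPotential β ρ) :=
      continuous_rieszPotential (sub_pos.2 hα) (sub_lt_self _ h0) hρm hρ hlb hi
    have hPB : ∀ x, rieszPotential β ρ x ≤ V.toReal := fun x => by
      rw [rieszPotential, integral_eq_lintegral_of_nonneg_ae (Eventually.of_forall (hnn x)) (hm x)]
      exact ENNReal.toReal_mono hfin.ne (hV x)
    refine ⟨fun x => (a * C)⁻¹ * rieszPotential β ρ x, continuous_const.mul hPc,
      ⟨(a * C)⁻¹ * V.toReal, fun x => ?_⟩, fun θ hθ hc => ?_⟩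
    · rw [abs_of_nonneg (mul_nonneg (by positivity) (rieszPotential_nonneg hρ x))]
      exact mul_le_mul_of_nonneg_left (hPB x) (by positivity)
    · have hP := integral_rieszPotential_mul (θ := θ) hρm hρ hi hPc hPB
        (integrable_secondDiffIntegral h0 h2 hθ hc) (hC θ hθ hc)
      have h : ∀ x, (a * C)⁻¹ * rieszPotential β ρ x * (a * secondDiffIntegral α θ x) =
          C⁻¹ * (rieszPotential β ρ x * secondDiffIntegral α θ x) := fun x => by
        field_simp
      simp only [h]
      rw [integral_const_mul, hP, neg_mul, mul_neg, inv_mul_cancel_left₀ hC0.ne']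

end BoundedSolutions

lemma fracLapCoeff_pos {N : ℕ} {α : ℝ} (h0 : 0 < α) (h2 : α < 2) : 0 < fracLapCoeff N α := by
  have h : Real.Gamma (-α / 2) ≠ 0 := by
    refine Real.Gamma_ne_zero fun m hm => ?_
    rcases Nat.eq_zero_or_pos m with rfl | hpos
    · simp only [Nat.cast_zero, neg_zero] at hm
      linarith
    · have : (1 : ℝ) ≤ m := by exact_mod_cast hpos
      linarith
  have hΓ : 0 < Real.Gamma (((N : ℝ) + α) / 2) := Real.Gamma_pos_of_pos (by positivity)
  unfold fracLapCoeff
  positivity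

lemma fracLap_eq (N : ℕ) (α : ℝ) (θ : EuclideanSpace ℝ (Fin N) → ℝ) (x : EuclideanSpace ℝ (Fin N)) :
    fracLap N α θ x = fracLapCoeff N α / 2 * secondDiffIntegral α θ x := by
  simp only [fracLap, secondDiffIntegral, secondDiff, finrank_euclideanSpace_fin]

/-- the linear equation `-Δ^{α/2}u = ρ` has a bounded continuous entire
(distributional) solution if and only if the Riesz potential of `ρ` is uniformly
bounded on `ℝ^N`. -/
theorem stmt14 (N : ℕ) (hN : 3 ≤ N) (α : ℝ) (hα1 : 0 < α) (hα2 : α < 2)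
    (ρ : EuclideanSpace ℝ (Fin N) → ℝ) (hρm : Measurable ρ) (hρnn : ∀ x, 0 ≤ ρ x)
    (hρlb : ∀ R : ℝ, ∃ M : ℝ, ∀ x : EuclideanSpace ℝ (Fin N), ‖x‖ ≤ R → ρ x ≤ M) :
    (∃ u : EuclideanSpace ℝ (Fin N) → ℝ, Continuous u ∧ (∃ M, ∀ x, |u x| ≤ M) ∧
      ∀ θ : EuclideanSpace ℝ (Fin N) → ℝ, ContDiff ℝ (⊤ : ℕ∞) θ → HasCompactSupport θ →
        (∫ x, u x * fracLap N α θ x) = -∫ x, ρ x * θ x) ↔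
    (⨆ x : EuclideanSpace ℝ (Fin N),
      ∫⁻ y, ENNReal.ofReal (ρ y * ‖x - y‖ ^ (-((N : ℝ) - α)))) < ⊤ := by
  have : Nontrivial (EuclideanSpace ℝ (Fin N)) :=
    Module.nontrivial_of_finrank_pos (R := ℝ) (by rw [finrank_euclideanSpace_fin]; omega)
  have hN' : (3 : ℝ) ≤ N := by exact_mod_cast hN
  have h := exists_bounded_solution_iff (E := EuclideanSpace ℝ (Fin N)) hα1 hα2
    (by rw [finrank_euclideanSpace_fin]; linarith) (half_pos (fracLapCoeff_pos (N := N) hα1 hα2))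
    hρm hρnn hρlb
  simpa only [fracLap_eq, finrank_euclideanSpace_fin] using h
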